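/- Let D be an n×d real matrix, let U be an n×r matrix and V an m×r matrix, each with orthonormal columns, and let C ⊆ {1,…,m} with |C| = s_c. Suppose there are constants α_u ≥ 0 and μ ≥ 0 such that every matrix H ∈ ℝ^{d×m} with column support contained in C satisfies ‖D H‖_F ≤ √α_u · ‖H‖_F and ‖𝒫_L(D H)‖_F ≤ μ · ‖D H‖_F. Let S ∈ ℝ^{d×m} have column support contained in C and let S̃ ∈ ℝ^{d×m} be defined by S̃_{:,j} = S_{:,j} / ‖S_{:,j}‖₂ for each j with S_{:,j} ≠ 0 and S̃_{:,j} = 0 otherwise. Then for any λ_c ≥ 0, ‖λ_c · S̃ − 𝒫_C(Dᵀ U Vᵀ)‖_F ≤ λ_c √s_c + √(r α_u) · μ. -/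

import Mathlib

open Matrix BigOperators

/-- Frobenius norm of a real matrix. -/
noncomputable def frob {n m : ℕ} (X : Matrix (Fin n) (Fin m) ℝ) : ℝ :=
  Real.sqrt (∑ i, ∑ j, X i j ^ 2)

/-- The projection operator `𝒫_L(X) = P X + X Q − P X Q`. -/
def PL {n m : ℕ} (P : Matrix (Fin n) (Fin n) ℝ) (Q : Matrix (Fin m) (Fin m) ℝ)
    (X : Matrix (Fin n) (Fin m) ℝ) : Matrix (Fin n) (Fin m) ℝ :=
  P * X + X * Q - P * X * Q

/-- Column-wise projection onto a set of columns C: keeps columns indexed by C, zeroes the rest. -/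
def projC {d m : ℕ} (C : Finset (Fin m))
    (X : Matrix (Fin d) (Fin m) ℝ) : Matrix (Fin d) (Fin m) ℝ :=
  fun i j => if j ∈ C then X i j else 0

lemma frob_sq {n m : ℕ} (X : Matrix (Fin n) (Fin m) ℝ) :
    frob X ^ 2 = ∑ i, ∑ j, X i j ^ 2 := by
  unfold frob
  exact Real.sq_sqrt (by positivity)

lemma frob_nonneg {n m : ℕ} (X : Matrix (Fin n) (Fin m) ℝ) : 0 ≤ frob X :=
  Real.sqrt_nonneg _

lemma trace_ip {n m : ℕ} (X Y : Matrix (Fin n) (Fin m) ℝ) :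
    (Xᵀ * Y).trace = ∑ i, ∑ j, X i j * Y i j := by
  simp only [Matrix.trace, Matrix.diag, Matrix.mul_apply, Matrix.transpose_apply]
  exact Finset.sum_comm

lemma frob_sq_trace {n m : ℕ} (X : Matrix (Fin n) (Fin m) ℝ) :
    frob X ^ 2 = (Xᵀ * X).trace := by
  rw [frob_sq, trace_ip]
  simp only [pow_two]

lemma frob_cs {n m : ℕ} (X Y : Matrix (Fin n) (Fin m) ℝ) :
    (Xᵀ * Y).trace ≤ frob X * frob Y := by
  rw [trace_ip]
  unfold frob
  simp only [← Fintype.sum_prod_type']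
  exact Real.sum_mul_le_sqrt_mul_sqrt Finset.univ (fun p : Fin n × Fin m => X p.1 p.2)
    (fun p => Y p.1 p.2)

lemma frob_sub_le {n m : ℕ} (X Y : Matrix (Fin n) (Fin m) ℝ) :
    frob (X - Y) ≤ frob X + frob Y := by
  have h := frob_cs X (-Y)
  have hn : frob (-Y) = frob Y := by simp [frob]
  rw [hn, trace_ip] at h
  refine (sq_le_sq₀ (frob_nonneg _) (add_nonneg (frob_nonneg X) (frob_nonneg Y))).mp ?_
  have e : frob (X - Y) ^ 2 = frob X ^ 2 + frob Y ^ 2 + 2 * ∑ i, ∑ j, X i j * (-Y) i j := by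
    simp only [frob_sq, Finset.mul_sum, ← Finset.sum_add_distrib]
    refine Finset.sum_congr rfl fun i _ => Finset.sum_congr rfl fun j _ => ?_
    simp only [Matrix.sub_apply, Matrix.neg_apply]
    ring
  nlinarith

lemma frob_smul {n m : ℕ} (c : ℝ) (hc : 0 ≤ c) (X : Matrix (Fin n) (Fin m) ℝ) :
    frob (c • X) = c * frob X := by
  unfold frob
  simp only [Matrix.smul_apply, smul_eq_mul, mul_pow, ← Finset.mul_sum]
  rw [Real.sqrt_mul (by positivity), Real.sqrt_sq hc]

theorem stmt4 {n d m r : ℕ} (s_c : ℕ)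
    (D : Matrix (Fin n) (Fin d) ℝ)
    (U : Matrix (Fin n) (Fin r) ℝ) (V : Matrix (Fin m) (Fin r) ℝ)
    (hU : Uᵀ * U = 1) (hV : Vᵀ * V = 1)
    (C : Finset (Fin m)) (hcard : C.card = s_c)
    (αu μ : ℝ) (hαu : 0 ≤ αu) (hμ : 0 ≤ μ)
    (hup : ∀ H : Matrix (Fin d) (Fin m) ℝ, (∀ j ∉ C, ∀ i, H i j = 0) →
      frob (D * H) ≤ Real.sqrt αu * frob H)
    (hinc : ∀ H : Matrix (Fin d) (Fin m) ℝ, (∀ j ∉ C, ∀ i, H i j = 0) →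
      frob (PL (U * Uᵀ) (V * Vᵀ) (D * H)) ≤ μ * frob (D * H))
    (S Stil : Matrix (Fin d) (Fin m) ℝ)
    (hS : ∀ j ∉ C, ∀ i, S i j = 0)
    (hStil : ∀ j : Fin m,
      ((fun i => S i j) ≠ 0 →
        ∀ i, Stil i j = S i j / Real.sqrt (∑ k, S k j ^ 2)) ∧
      ((fun i => S i j) = 0 → ∀ i, Stil i j = 0))
    (lam_c : ℝ) (hlam : 0 ≤ lam_c) :
    frob (lam_c • Stil - projC C (Dᵀ * U * Vᵀ)) ≤
      lam_c * Real.sqrt s_c + Real.sqrt (r * αu) * μ := by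
  have hA : frob Stil ≤ Real.sqrt s_c := by
    unfold frob
    apply Real.sqrt_le_sqrt
    rw [Finset.sum_comm, ← hcard]
    have hcol : ∀ j, ∑ i, Stil i j ^ 2 ≤ if j ∈ C then (1 : ℝ) else 0 := by
      intro j
      by_cases h0 : (fun i => S i j) = 0
      · simp only [(hStil j).2 h0]
        split_ifs <;> simp
      · have hj : j ∈ C := by
          by_contra hj
          exact h0 (funext fun i => hS j hj i)
        simp only [(hStil j).1 h0, hj, if_true, div_pow]
        rw [← Finset.sum_div, Real.sq_sqrt (by positivity)]
        exact div_self_le_one _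
    calc _ ≤ ∑ j, if j ∈ C then (1 : ℝ) else 0 := Finset.sum_le_sum fun j _ => hcol j
      _ = _ := by simp
  have hB : frob (projC C (Dᵀ * U * Vᵀ)) ≤ Real.sqrt (r * αu) * μ := by
    set Y := projC C (Dᵀ * U * Vᵀ) with hY
    have hsupp : ∀ j ∉ C, ∀ i, Y i j = 0 := by
      intro j hj i
      simp [hY, projC, hj]
    have h1 : frob Y ^ 2 = (Yᵀ * (Dᵀ * U * Vᵀ)).trace := by
      rw [frob_sq, trace_ip]
      refine Finset.sum_congr rfl fun i _ => Finset.sum_congr rfl fun j _ => ?_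
      by_cases hj : j ∈ C
      · simp [hY, projC, hj, pow_two]
      · simp [hsupp j hj i]
    have h2 : (PL (U * Uᵀ) (V * Vᵀ) (D * Y))ᵀ * (U * Vᵀ) = Yᵀ * (Dᵀ * U * Vᵀ) := by
      have hUU : Uᵀ * (U * Vᵀ) = Vᵀ := by rw [← Matrix.mul_assoc, hU, Matrix.one_mul]
      simp only [PL, Matrix.transpose_sub, Matrix.transpose_add, Matrix.transpose_mul,
        Matrix.transpose_transpose, Matrix.sub_mul, Matrix.add_mul, Matrix.mul_assoc, hUU]
      simp
    have h3 : frob (U * Vᵀ) = Real.sqrt r := by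
      rw [← Real.sqrt_sq (frob_nonneg (U * Vᵀ)), frob_sq_trace]
      congr 1
      rw [Matrix.transpose_mul, Matrix.transpose_transpose, Matrix.mul_assoc,
        ← Matrix.mul_assoc Uᵀ, hU, Matrix.one_mul, Matrix.trace_mul_comm, hV]
      simp
    have h4 := frob_cs (PL (U * Uᵀ) (V * Vᵀ) (D * Y)) (U * Vᵀ)
    rw [h2, ← h1, h3] at h4
    have h5 : frob (PL (U * Uᵀ) (V * Vᵀ) (D * Y)) ≤ μ * (Real.sqrt αu * frob Y) :=
      (hinc Y hsupp).trans (mul_le_mul_of_nonneg_left (hup Y hsupp) hμ)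
    have h6 := h4.trans (mul_le_mul_of_nonneg_right h5 (Real.sqrt_nonneg (r : ℝ)))
    rw [Real.sqrt_mul (Nat.cast_nonneg r)]
    rcases (frob_nonneg Y).eq_or_lt with h | h
    · rw [← h]; positivity
    · refine le_of_mul_le_mul_right ?_ h
      calc frob Y * frob Y = frob Y ^ 2 := by ring
        _ ≤ _ := h6
        _ = _ := by ring
  calc _ ≤ frob (lam_c • Stil) + frob (projC C (Dᵀ * U * Vᵀ)) := frob_sub_le _ _
    _ ≤ _ := by
      rw [frob_smul _ hlam]
      exact add_le_add (mul_le_mul_of_nonneg_left hA hlam) hB
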